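/- Let n ≥ 2, A(s) ∈ F[s]^{n×n} a regular pencil with invariant factors α₁(s) | ⋯ | α_n(s), and q(s) ∈ F[s] a nonzero monic polynomial with deg(q) ≤ n. Assume F ∪ {∞} is not contained in Λ(A(s)) ∪ Λⁿ(q(s)). Let 0 ≤ r ≤ n. Then there exists a pencil P(s) ∈ F[s]^{n×n} with normal rank exactly r such that det(A(s) + P(s)) = k·q(s) for some nonzero k ∈ F, if and only if α₁(s)⋯α_{n−r}(s) divides q(s) and Σ_{i=1}^{n−r} m_i(∞, A(s)) ≤ n − deg(q(s)). -/

import Mathlib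

/-- A polynomial matrix is a (matrix) pencil if every entry has degree at most 1. -/
def IsPencil {F : Type*} [Field F] {m n : ℕ} (M : Matrix (Fin m) (Fin n) (Polynomial F)) : Prop :=
  ∀ i j, (M i j).degree ≤ 1

/-- Normal rank of a polynomial matrix: its rank over the field of rational functions. -/
noncomputable def normalRank {F : Type*} [Field F] {m n : ℕ}
    (M : Matrix (Fin m) (Fin n) (Polynomial F)) : ℕ :=
  (M.map (algebraMap (Polynomial F) (RatFunc F))).rank

/-- Strict equivalence of polynomial matrices (pencils):
`G = Q * H * R` for invertible constant matrices `Q`, `R`. -/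
def StrictEquiv {F : Type*} [Field F] {m n : ℕ}
    (G H : Matrix (Fin m) (Fin n) (Polynomial F)) : Prop :=
  ∃ (Q : Matrix (Fin m) (Fin m) F) (R : Matrix (Fin n) (Fin n) F),
    IsUnit Q.det ∧ IsUnit R.det ∧ G = (Q.map Polynomial.C) * H * (R.map Polynomial.C)

/-- The pencil `G₀ + s G₁` as a polynomial matrix. -/
noncomputable def pencilOf {F : Type*} [Field F] {m n : ℕ}
    (G₀ G₁ : Matrix (Fin m) (Fin n) F) : Matrix (Fin m) (Fin n) (Polynomial F) :=
  G₀.map Polynomial.C + (Polynomial.X : Polynomial F) • G₁.map Polynomial.C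

/-- The homogeneous pencil `t G₀ + s G₁` (variables `s = X 0`, `t = X 1`). -/
noncomputable def homPencil {F : Type*} [Field F] {m n : ℕ}
    (G₀ G₁ : Matrix (Fin m) (Fin n) F) : Matrix (Fin m) (Fin n) (MvPolynomial (Fin 2) F) :=
  (MvPolynomial.X 1 : MvPolynomial (Fin 2) F) • G₀.map MvPolynomial.C +
    (MvPolynomial.X 0 : MvPolynomial (Fin 2) F) • G₁.map MvPolynomial.C

/-- The set of `k × k` minors of a matrix. -/
def minorsSet {R : Type*} [CommRing R] {m n : ℕ} (M : Matrix (Fin m) (Fin n) R) (k : ℕ) :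
    Set R :=
  { d | ∃ (ri : Fin k → Fin m) (ci : Fin k → Fin n),
      Function.Injective ri ∧ Function.Injective ci ∧ d = (M.submatrix ri ci).det }

/-- `g` is a greatest common divisor of the set `S`. -/
def IsGCDOf {R : Type*} [CommRing R] (g : R) (S : Set R) : Prop :=
  (∀ x ∈ S, g ∣ x) ∧ ∀ d : R, (∀ x ∈ S, d ∣ x) → d ∣ g

/-- `φ 0, …, φ (n-1)` are homogeneous invariant factors (up to units) of the pencil
`G₀ + s G₁`: for each `k ≤ n` the product of the first `k` of them is a gcd of the
`k × k` minors of the homogeneous pencil `t G₀ + s G₁`. -/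
def IsHomogeneousIF {F : Type*} [Field F] {n : ℕ} (G₀ G₁ : Matrix (Fin n) (Fin n) F)
    (φ : ℕ → MvPolynomial (Fin 2) F) : Prop :=
  ∀ k : ℕ, k ≤ n → IsGCDOf (∏ i ∈ Finset.range k, φ i) (minorsSet (homPencil G₀ G₁) k)

/-- Extension of a finite family of invariant factors (indexed `1, …, n`, stored with
offset `1` so that `φ 0` is the first one) to all integer indices, with the convention
that it is `1` below the range and `0` above it. -/
def extIF {R : Type*} [CommRing R] (n : ℕ) (φ : ℕ → R) : ℤ → R :=
  fun j => if j < 1 then 1 else if (n : ℤ) < j then 0 else φ (j - 1).toNat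

/-- Interlacing condition `φ_{i-r} ∣ ψ_i ∣ φ_{i+r}`, `1 ≤ i ≤ n`. -/
def Interlace {R : Type*} [CommRing R] (n r : ℕ) (φ ψ : ℕ → R) : Prop :=
  ∀ i : ℕ, 1 ≤ i → i ≤ n →
    extIF n φ ((i : ℤ) - r) ∣ extIF n ψ (i : ℤ) ∧
      extIF n ψ (i : ℤ) ∣ extIF n φ ((i : ℤ) + r)

/-- The operation `P_X` on pencils, acting on the pair `(G₀, G₁)` of coefficients of
`G(s) = G₀ + s G₁`: for `X = [[x, y], [z, w]]`,
`P_X(s G₁ + G₀) = s (x G₁ + z G₀) + (y G₁ + w G₀)`. -/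
def mapP {F : Type*} [Field F] {m n : ℕ} (X : Matrix (Fin 2) (Fin 2) F)
    (G : Matrix (Fin m) (Fin n) F × Matrix (Fin m) (Fin n) F) :
    Matrix (Fin m) (Fin n) F × Matrix (Fin m) (Fin n) F :=
  (X 0 1 • G.2 + X 1 1 • G.1, X 0 0 • G.2 + X 1 0 • G.1)

/-- The substitution `Π_X(Φ)(s, t) = Φ(s x + t y, s z + t w)` for `X = [[x, y], [z, w]]`. -/
noncomputable def PiX {F : Type*} [Field F] (X : Matrix (Fin 2) (Fin 2) F)
    (Φ : MvPolynomial (Fin 2) F) : MvPolynomial (Fin 2) F :=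
  MvPolynomial.aeval
    ![MvPolynomial.C (X 0 0) * MvPolynomial.X 0 + MvPolynomial.C (X 0 1) * MvPolynomial.X 1,
      MvPolynomial.C (X 1 0) * MvPolynomial.X 0 + MvPolynomial.C (X 1 1) * MvPolynomial.X 1] Φ

/-- The homogeneous invariant factor of a nonzero `1 × 1` pencil `a(s) = a₀ + s a₁`:
the homogenization `t a₀ + s a₁`, made monic with respect to `s`
(equal to `t` when `a₁ = 0`). -/
noncomputable def homIF1 {F : Type*} [Field F] (a : Polynomial F) : MvPolynomial (Fin 2) F :=
  MvPolynomial.C (a.leadingCoeff)⁻¹ *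
    (MvPolynomial.C (a.coeff 1) * MvPolynomial.X 0 + MvPolynomial.C (a.coeff 0) * MvPolynomial.X 1)

/-- The homogeneous pencil associated to a polynomial matrix pencil. -/
noncomputable def homOf {F : Type*} [Field F] {n : ℕ}
    (M : Matrix (Fin n) (Fin n) (Polynomial F)) : Matrix (Fin n) (Fin n) (MvPolynomial (Fin 2) F) :=
  homPencil (M.map fun p => p.coeff 0) (M.map fun p => p.coeff 1)

theorem dvd_det_submatrix_mul_left {R : Type*} [CommRing R] {m n k : ℕ} {e : R}
    (L : Matrix (Fin m) (Fin m) R) (A : Matrix (Fin m) (Fin n) R)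
    (h : ∀ (ri : Fin k → Fin m) (ci : Fin k → Fin n), e ∣ (A.submatrix ri ci).det)
    (ri : Fin k → Fin m) (ci : Fin k → Fin n) : e ∣ ((L * A).submatrix ri ci).det := by
  have h1 : ((L * A).submatrix ri ci).det =
      Matrix.detRowAlternating.toMultilinearMap
        (fun i => ∑ l : Fin m, L (ri i) l • (fun j => A l (ci j))) := by
    change _ = Matrix.det _
    congr 1
    ext i j
    simp [Matrix.mul_apply, Finset.sum_apply]
  rw [h1, MultilinearMap.map_sum]
  refine Finset.dvd_sum fun f _ => ?_
  rw [MultilinearMap.map_smul_univ]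
  exact Dvd.dvd.mul_left (h f ci) _

theorem dvd_det_submatrix_mul_right {R : Type*} [CommRing R] {m n k : ℕ} {e : R}
    (A : Matrix (Fin m) (Fin n) R) (L : Matrix (Fin n) (Fin n) R)
    (h : ∀ (ri : Fin k → Fin m) (ci : Fin k → Fin n), e ∣ (A.submatrix ri ci).det)
    (ri : Fin k → Fin m) (ci : Fin k → Fin n) : e ∣ ((A * L).submatrix ri ci).det := by
  have := dvd_det_submatrix_mul_left L.transpose A.transpose
    (fun ri ci => by
      rw [← Matrix.transpose_submatrix, Matrix.det_transpose]
      exact h ci ri) ci ri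
  rwa [← Matrix.transpose_mul, ← Matrix.transpose_submatrix, Matrix.det_transpose] at this

theorem dvd_det_submatrix_of_injective {R : Type*} [CommRing R] {m n k : ℕ} {e : R}
    (A : Matrix (Fin m) (Fin n) R)
    (h : ∀ (ri : Fin k → Fin m) (ci : Fin k → Fin n), ri.Injective → ci.Injective →
      e ∣ (A.submatrix ri ci).det)
    (ri : Fin k → Fin m) (ci : Fin k → Fin n) : e ∣ (A.submatrix ri ci).det := by
  by_cases hr : ri.Injective
  · by_cases hc : ci.Injective
    · exact h ri ci hr hc
    · obtain ⟨i, j, hij, hne⟩ : ∃ i j, ci i = ci j ∧ i ≠ j := by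
        simpa [Function.Injective] using hc
      rw [Matrix.det_zero_of_column_eq hne (fun l => by simp [hij])]
      exact dvd_zero _
  · obtain ⟨i, j, hij, hne⟩ : ∃ i j, ri i = ri j ∧ i ≠ j := by
      simpa [Function.Injective] using hr
    rw [Matrix.det_zero_of_row_eq hne (by ext l; simp [hij])]
    exact dvd_zero _

theorem prod_castLE_dvd_prod_of_injective {R : Type*} [CommRing R] {n k : ℕ} (hk : k ≤ n)
    (d : Fin n → R) (hd : ∀ i j, i ≤ j → d i ∣ d j) (f : Fin k → Fin n) (hf : f.Injective) :
    ∏ i, d (Fin.castLE hk i) ∣ ∏ i, d (f i) := by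
  have hcard : (Finset.univ.image f).card = k := by
    rw [Finset.card_image_of_injective _ hf, Finset.card_fin]
  have h1 : ∏ i, d (f i) = ∏ i, d ((Finset.univ.image f).orderEmbOfFin hcard i) := by
    rw [← Finset.prod_image (s := Finset.univ) (g := f) (f := d) (fun a _ b _ h => hf h),
      ← Finset.prod_image (s := Finset.univ)
        (g := (Finset.univ.image f).orderEmbOfFin hcard) (f := d)
        (fun a _ b _ h => (RelEmbedding.injective _) h), Finset.image_orderEmbOfFin_univ]
  rw [h1]
  refine Finset.prod_dvd_prod_of_dvd _ _ fun i _ => hd _ _ ?_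
  have hmono : StrictMono ((Finset.univ.image f).orderEmbOfFin hcard) :=
    OrderEmbedding.strictMono _
  generalize ⇑((Finset.univ.image f).orderEmbOfFin hcard) = g at hmono
  obtain ⟨i, hi⟩ := i
  change i ≤ (g ⟨i, hi⟩ : ℕ)
  induction i with
  | zero => simp
  | succ i ih =>
    have h1 : i ≤ (g ⟨i, by omega⟩ : ℕ) := ih (by omega) (by simp)
    have h2 : g ⟨i, by omega⟩ < g ⟨i + 1, hi⟩ := hmono (by simp)
    rw [Fin.lt_def] at h2
    omega

theorem prod_dvd_det_submatrix_diagonal {R : Type*} [CommRing R] {n k : ℕ} (hk : k ≤ n)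
    (d : Fin n → R) (hd : ∀ i j, i ≤ j → d i ∣ d j) (ri ci : Fin k → Fin n) :
    ∏ i, d (Fin.castLE hk i) ∣ ((Matrix.diagonal d).submatrix ri ci).det := by
  refine dvd_det_submatrix_of_injective _ (fun ri ci hr _ => ?_) ri ci
  have h1 : (Matrix.diagonal d).submatrix ri ci =
      Matrix.diagonal (fun i => d (ri i)) * ((1 : Matrix (Fin n) (Fin n) R).submatrix ri ci) := by
    ext i j
    simp [Matrix.diagonal_mul, Matrix.diagonal_apply, Matrix.one_apply]
  rw [h1, Matrix.det_mul, Matrix.det_diagonal]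
  exact (prod_castLE_dvd_prod_of_injective hk d hd ri hr).mul_right _

/-- Laplace expansion: a common divisor of the maximal minors of some rows divides the
determinant. -/
theorem dvd_det_of_dvd_row_minors {R : Type*} [CommRing R] {k : ℕ} {e : R} : ∀ (n : ℕ)
    (M : Matrix (Fin n) (Fin n) R) (ri : Fin k → Fin n), ri.Injective →
    (∀ ci : Fin k → Fin n, ci.Injective → e ∣ (M.submatrix ri ci).det) → e ∣ M.det := by
  intro n
  induction n with
  | zero =>
    intro M ri hri h
    have hk : k = 0 := by simpa using Fintype.card_le_of_injective ri hri
    subst hk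
    simpa using h ri hri
  | succ n ih =>
    intro M ri hri h
    by_cases hs : ri.Surjective
    · let σ := Equiv.ofBijective ri ⟨hri, hs⟩
      have := h σ σ.injective
      have h2 : M.submatrix ri σ = M.submatrix σ σ := rfl
      rwa [h2, Matrix.det_submatrix_equiv_self] at this
    · obtain ⟨i, hi⟩ : ∃ i, ∀ j, ri j ≠ i := by simpa [Function.Surjective] using hs
      rw [Matrix.det_succ_row M i]
      refine Finset.dvd_sum fun j _ => Dvd.dvd.mul_left ?_ _
      choose g hg using fun l => Fin.exists_succAbove_eq (hi l)
      refine ih _ g (fun a b hab => hri (by rw [← hg a, ← hg b, hab])) fun ci hci => ?_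
      have := h (j.succAbove ∘ ci) (Fin.succAbove_right_injective.comp hci)
      convert this using 2
      ext a b
      simp [hg]

/-- A common divisor of the `k × k` minors of `A` divides `det (A + P)` if all
`(r + 1) × (r + 1)` minors of `P` vanish and `k + r ≤ n`. -/
theorem dvd_det_add_of_minors {R : Type*} [CommRing R] {n k r : ℕ} (hn : k + r ≤ n) {e : R}
    (A P : Matrix (Fin n) (Fin n) R)
    (hA : ∀ (ri ci : Fin k → Fin n), ri.Injective → ci.Injective → e ∣ (A.submatrix ri ci).det)
    (hP : ∀ (ri ci : Fin (r + 1) → Fin n), (P.submatrix ri ci).det = 0) :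
    e ∣ (A + P).det := by
  change e ∣ Matrix.detRowAlternating (fun i => A i + P i)
  rw [show (fun i => A i + P i) = (fun i => A i) + (fun i => P i) from rfl,
    AlternatingMap.map_add_univ]
  refine Finset.dvd_sum fun s _ => ?_
  change e ∣ Matrix.det _
  have hcard := Finset.card_add_card_compl s
  rw [Fintype.card_fin] at hcard
  rcases le_or_gt k s.card with hs | hs
  · refine dvd_det_of_dvd_row_minors _ _ (fun i => s.orderEmbOfFin rfl (Fin.castLE hs i))
      (fun a b h => by simpa using h) fun ci hci => ?_
    convert hA (fun i => s.orderEmbOfFin rfl (Fin.castLE hs i)) ci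
      (fun a b h => by simpa using h) hci using 2
    ext a b
    exact congrFun (Finset.piecewise_eq_of_mem s (fun i => A i) (fun i => P i)
      (Finset.orderEmbOfFin_mem _ _ _)) _
  · have hs' : r + 1 ≤ sᶜ.card := by omega
    have h0 : (0 : R) ∣ Matrix.det (s.piecewise (fun i => A i) (fun i => P i)) := by
      refine dvd_det_of_dvd_row_minors _ _ (fun i => sᶜ.orderEmbOfFin rfl (Fin.castLE hs' i))
        (fun a b h => by simpa using h) fun ci hci => ?_
      rw [← hP (fun i => sᶜ.orderEmbOfFin rfl (Fin.castLE hs' i)) ci]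
      apply dvd_of_eq
      congr 1
      ext a b
      have : sᶜ.orderEmbOfFin rfl (Fin.castLE hs' a) ∉ s :=
        Finset.mem_compl.1 (Finset.orderEmbOfFin_mem _ _ _)
      exact (congrFun (Finset.piecewise_eq_of_notMem s (fun i => A i) (fun i => P i) this) _).symm
    rw [zero_dvd_iff.1 h0]
    exact dvd_zero _

/-- The block diagonal matrix with a single corner entry `p` and a block `U`. -/
def cornerBlock {R : Type*} [CommRing R] {n : ℕ} (p : R) (U : Matrix (Fin n) (Fin n) R) :
    Matrix (Fin (n + 1)) (Fin (n + 1)) R :=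
  Matrix.of fun i j => Fin.cases (Fin.cases p (fun _ => 0) j)
    (fun i' => Fin.cases 0 (fun j' => U i' j') j) i

theorem cornerBlock_mul {R : Type*} [CommRing R] {n : ℕ} (p q : R)
    (U V : Matrix (Fin n) (Fin n) R) :
    cornerBlock p U * cornerBlock q V = cornerBlock (p * q) (U * V) := by
  ext i j
  refine Fin.cases ?_ (fun i' => ?_) i <;> refine Fin.cases ?_ (fun j' => ?_) j <;>
    simp [cornerBlock, Matrix.mul_apply, Fin.sum_univ_succ]

theorem cornerBlock_diagonal {R : Type*} [CommRing R] {n : ℕ} (p : R) (d : Fin n → R) :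
    cornerBlock p (Matrix.diagonal d) = Matrix.diagonal (Fin.cons p d) := by
  ext i j
  refine Fin.cases ?_ (fun i' => ?_) i <;> refine Fin.cases ?_ (fun j' => ?_) j <;>
    simp [cornerBlock, Matrix.diagonal_apply]
  simp [Fin.ext_iff]

theorem isUnit_cornerBlock {R : Type*} [CommRing R] {n : ℕ}
    {U : Matrix (Fin n) (Fin n) R} (hU : IsUnit U) : IsUnit (cornerBlock 1 U) := by
  obtain ⟨u, rfl⟩ := hU
  have h1 : cornerBlock (1 : R) (1 : Matrix (Fin n) (Fin n) R) = 1 := by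
    rw [← Matrix.diagonal_one, cornerBlock_diagonal, ← Matrix.diagonal_one]
    congr 1
    ext i
    refine Fin.cases ?_ (fun i' => ?_) i <;> simp
  refine ⟨⟨cornerBlock 1 u, cornerBlock 1 (u⁻¹ : (Matrix (Fin n) (Fin n) R)ˣ), ?_, ?_⟩, rfl⟩ <;>
    simp [cornerBlock_mul, h1]

/-- `1 + c e₀ᵀ` is invertible when `c` has zero first entry. -/
theorem isUnit_one_add_vecMulVec {R ι : Type*} [CommRing R] [Fintype ι] [DecidableEq ι]
    (u v : ι → R) (h : v ⬝ᵥ u = 0) : IsUnit (1 + Matrix.vecMulVec u v) := by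
  rw [Matrix.isUnit_iff_isUnit_det, Matrix.vecMulVec_eq Unit,
    Matrix.det_one_add_replicateCol_mul_replicateRow, h]
  simp

/-- Equivalence of square matrices. -/
def MatEquiv {R : Type*} [CommRing R] {n : ℕ} (A B : Matrix (Fin n) (Fin n) R) : Prop :=
  ∃ U V : Matrix (Fin n) (Fin n) R, IsUnit U ∧ IsUnit V ∧ U * A * V = B

theorem MatEquiv.trans {R : Type*} [CommRing R] {n : ℕ} {A B C : Matrix (Fin n) (Fin n) R}
    (h : MatEquiv A B) (h' : MatEquiv B C) : MatEquiv A C := by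
  obtain ⟨U, V, hU, hV, rfl⟩ := h
  obtain ⟨U', V', hU', hV', rfl⟩ := h'
  exact ⟨U' * U, V * V', hU'.mul hU, hV.mul hV', by simp only [Matrix.mul_assoc]⟩

theorem MatEquiv.mul_left {R : Type*} [CommRing R] {n : ℕ} {A B : Matrix (Fin n) (Fin n) R}
    (h : MatEquiv A B) {U : Matrix (Fin n) (Fin n) R} (hU : IsUnit U) : MatEquiv A (U * B) :=
  h.trans ⟨U, 1, hU, isUnit_one, by simp⟩

theorem MatEquiv.mul_right {R : Type*} [CommRing R] {n : ℕ} {A B : Matrix (Fin n) (Fin n) R}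
    (h : MatEquiv A B) {V : Matrix (Fin n) (Fin n) R} (hV : IsUnit V) : MatEquiv A (B * V) :=
  h.trans ⟨1, V, isUnit_one, hV, by simp⟩

theorem MatEquiv.transpose {R : Type*} [CommRing R] {n : ℕ} {A B : Matrix (Fin n) (Fin n) R}
    (h : MatEquiv A B) : MatEquiv A.transpose B.transpose := by
  obtain ⟨U, V, hU, hV, rfl⟩ := h
  exact ⟨V.transpose, U.transpose, by simpa using hV, by simpa using hU, by
    simp [Matrix.mul_assoc]⟩

theorem MatEquiv.dvd {R : Type*} [CommRing R] {n : ℕ} {A B : Matrix (Fin n) (Fin n) R}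
    (h : MatEquiv A B) {p : R} (hp : ∀ i j, p ∣ A i j) (i j : Fin n) : p ∣ B i j := by
  obtain ⟨U, V, -, -, rfl⟩ := h
  simp only [Matrix.mul_apply]
  exact Finset.dvd_sum fun l _ => Dvd.dvd.mul_right
    (Finset.dvd_sum fun k _ => Dvd.dvd.mul_left (hp _ _) _) _

theorem isUnit_swap_matrix {R ι : Type*} [CommRing R] [Fintype ι] [DecidableEq ι]
    (σ : Equiv.Perm ι) : IsUnit ((1 : Matrix ι ι R).submatrix σ id) := by
  rw [Matrix.isUnit_iff_isUnit_det, Matrix.det_permute, Matrix.det_one, mul_one]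
  exact (Equiv.Perm.sign σ).isUnit.map (Int.castRingHom R)

/-- A nonzero entry of minimal degree in position `(0, 0)` among all equivalent matrices divides
the first row of any equivalent matrix having it in that position. -/
theorem corner_dvd_row {F : Type*} [Field F] {n : ℕ}
    {A B : Matrix (Fin (n + 1)) (Fin (n + 1)) (Polynomial F)} {p : Polynomial F}
    (hmin : ∀ B, MatEquiv A B → ∀ i j, B i j ≠ 0 → p.natDegree ≤ (B i j).natDegree)
    (hp : p ≠ 0) (hB : MatEquiv A B) (hBp : B 0 0 = p) (j : Fin (n + 1)) : p ∣ B 0 j := by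
  rcases eq_or_ne j 0 with rfl | hj
  · rw [hBp]
  set c := B 0 j / p with hc
  have hV : IsUnit (1 + Matrix.vecMulVec (Pi.single 0 (-c)) (Pi.single j 1) :
      Matrix (Fin (n + 1)) (Fin (n + 1)) (Polynomial F)) :=
    isUnit_one_add_vecMulVec _ _ (by simp [hj])
  have h := hmin _ (hB.mul_right hV) 0 j
  have he : (B * (1 + Matrix.vecMulVec (Pi.single 0 (-c)) (Pi.single j 1)) :
      Matrix (Fin (n + 1)) (Fin (n + 1)) (Polynomial F)) 0 j = B 0 j % p := by
    rw [Matrix.mul_add, Matrix.mul_one, Matrix.add_apply, Matrix.mul_vecMulVec,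
      Matrix.vecMulVec_apply]
    simp only [Matrix.mulVec_single, Pi.single_eq_same, mul_one]
    simp [hBp]
    rw [eq_comm, EuclideanDomain.mod_eq_sub_mul_div]
    ring
  rw [he] at h
  by_contra hd
  have hne : B 0 j % p ≠ 0 := fun h0 => hd (EuclideanDomain.mod_eq_zero.1 h0)
  have := h hne
  have h2 := Polynomial.degree_mod_lt (B 0 j) hp
  exact absurd (Polynomial.natDegree_lt_natDegree hne h2) (by omega)

theorem exists_smith {F : Type*} [Field F] : ∀ (n : ℕ)
    (A : Matrix (Fin n) (Fin n) (Polynomial F)), ∃ d : Fin n → Polynomial F,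
      MatEquiv A (Matrix.diagonal d) ∧ ∀ i j, i ≤ j → d i ∣ d j := by
  intro n
  induction n with
  | zero => exact fun A => ⟨fun _ => 0, ⟨1, 1, isUnit_one, isUnit_one, by ext i; exact i.elim0⟩,
      fun i => i.elim0⟩
  | succ n ih =>
    intro A
    by_cases hA : A = 0
    · exact ⟨fun _ => 0, ⟨1, 1, isUnit_one, isUnit_one, by simp [hA]⟩, by simp⟩
    have hAA : MatEquiv A A := ⟨1, 1, isUnit_one, isUnit_one, by simp⟩
    -- a nonzero entry of minimal degree, moved to the corner
    obtain ⟨p, hp, hmin, B, hB, hBp⟩ : ∃ p : Polynomial F, p ≠ 0 ∧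
        (∀ B, MatEquiv A B → ∀ i j, B i j ≠ 0 → p.natDegree ≤ (B i j).natDegree) ∧
        ∃ B, MatEquiv A B ∧ B 0 0 = p := by
      let S : Set ℕ := {k | ∃ B, MatEquiv A B ∧ ∃ i j, B i j ≠ 0 ∧ (B i j).natDegree = k}
      have hS : S.Nonempty := by
        obtain ⟨i, j, hij⟩ : ∃ i j, A i j ≠ 0 := by
          by_contra! h
          exact hA (Matrix.ext h)
        exact ⟨_, A, hAA, i, j, hij, rfl⟩
      obtain ⟨B, hB, i, j, hij, hk⟩ := Nat.sInf_mem hS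
      refine ⟨B i j, hij, fun B' hB' i' j' h' => ?_, ?_⟩
      · rw [hk]
        exact Nat.sInf_le ⟨B', hB', i', j', h', rfl⟩
      · refine ⟨((1 : Matrix (Fin (n + 1)) (Fin (n + 1)) (Polynomial F)).submatrix (Equiv.swap 0 i) id) * B *
          ((1 : Matrix (Fin (n + 1)) (Fin (n + 1)) (Polynomial F)).submatrix (Equiv.swap 0 j) id).transpose,
          (hB.mul_left (isUnit_swap_matrix _)).mul_right
            ((Matrix.isUnit_transpose _).2 (isUnit_swap_matrix _)), ?_⟩
        simp [Matrix.mul_apply, Matrix.one_apply]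
    have hrow := fun B' hB' hp' => corner_dvd_row (B := B') hmin hp hB' hp'
    have hcol : ∀ B', MatEquiv A B' → B' 0 0 = p → ∀ i, p ∣ B' i 0 := by
      intro B' hB' hp' i
      refine corner_dvd_row (A := A.transpose) (B := B'.transpose) (fun C hC i j h => ?_) hp
        hB'.transpose hp' i
      exact hmin C.transpose (by simpa using hC.transpose) j i h
    -- clear the first column
    obtain ⟨C, hC, hCp, hC0⟩ : ∃ C, MatEquiv A C ∧ C 0 0 = p ∧ ∀ i, i ≠ 0 → C i 0 = 0 := by
      choose c hc using hcol B hB hBp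
      refine ⟨_, hB.mul_left (isUnit_one_add_vecMulVec (Function.update (-c) 0 0) (Pi.single 0 1)
        (by simp)), ?_, fun i hi => ?_⟩ <;>
      rw [Matrix.add_mul, Matrix.one_mul, Matrix.add_apply, Matrix.vecMulVec_mul,
        Matrix.vecMulVec_apply]
      · simp [hBp]
      · simp [hi, hBp, hc i]
        ring
    -- clear the first row
    obtain ⟨D, hD, hDp, hD0, hD0'⟩ : ∃ D, MatEquiv A D ∧ D 0 0 = p ∧ (∀ i, i ≠ 0 → D i 0 = 0) ∧
        ∀ j, j ≠ 0 → D 0 j = 0 := by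
      choose c hc using hrow C hC hCp
      have hCc : ∀ i, (C.mulVec (Pi.single 0 1)) i = C i 0 := by simp
      refine ⟨_, hC.mul_right (isUnit_one_add_vecMulVec (Pi.single 0 1) (Function.update (-c) 0 0)
        (by simp)), ?_, fun i hi => ?_, fun j hj => ?_⟩ <;>
      rw [Matrix.mul_add, Matrix.mul_one, Matrix.add_apply, Matrix.mul_vecMulVec,
        Matrix.vecMulVec_apply, hCc]
      · simp [hCp]
      · simp [hC0 i hi]
      · simp [hj, hCp, hc j]
    have hdvd : ∀ i j : Fin n, p ∣ D i.succ j.succ := by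
      intro i j
      have h := hrow _ (hD.mul_left (isUnit_one_add_vecMulVec (Pi.single 0 1)
        (Pi.single i.succ 1) (by simp))) ?_ j.succ
      · rw [Matrix.add_mul, Matrix.one_mul, Matrix.add_apply, Matrix.vecMulVec_mul,
          Matrix.vecMulVec_apply] at h
        simpa [hD0'] using h
      · rw [Matrix.add_mul, Matrix.one_mul, Matrix.add_apply, Matrix.vecMulVec_mul,
          Matrix.vecMulVec_apply]
        simp [hDp, hD0]
    have hDblock : D = cornerBlock p (D.submatrix Fin.succ Fin.succ) := by
      ext i j
      refine Fin.cases ?_ (fun i' => ?_) i <;> refine Fin.cases ?_ (fun j' => ?_) j <;>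
        simp [cornerBlock, hDp, hD0, hD0']
    obtain ⟨d, hd, hdd⟩ := ih (D.submatrix Fin.succ Fin.succ)
    have hpd : ∀ j, p ∣ d j := fun j => by
      simpa using hd.dvd (p := p) (by simpa using hdvd) j j
    refine ⟨Fin.cons p d, ?_, fun i j => ?_⟩
    · obtain ⟨U, V, hU, hV, hUV⟩ := hd
      refine hD.trans ⟨cornerBlock 1 U, cornerBlock 1 V, isUnit_cornerBlock hU,
        isUnit_cornerBlock hV, ?_⟩
      rw [hDblock, cornerBlock_mul, cornerBlock_mul, hUV, cornerBlock_diagonal]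
      simp
    · refine Fin.cases (fun _ => ?_) (fun i' => ?_) i
      · refine Fin.cases ?_ (fun j' => ?_) j <;> simp [hpd]
      · refine Fin.cases (fun h => ?_) (fun j' h => ?_) j
        · exact absurd h (by simp)
        · simpa using hdd i' j' (by simpa using h)

theorem charpoly_blockDiagonal' {R : Type*} [CommRing R] {k : ℕ} {m : Fin k → Type*}
    [∀ i, Fintype (m i)] [∀ i, DecidableEq (m i)] (M : ∀ i, Matrix (m i) (m i) R) :
    (Matrix.blockDiagonal' M).charpoly = ∏ i, (M i).charpoly := by
  have ht : (Matrix.blockDiagonal' M).charmatrix.BlockTriangular Sigma.fst := by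
    rintro ⟨i, a⟩ ⟨j, b⟩ h
    have hne : i ≠ j := (ne_of_lt h).symm
    rw [Matrix.charmatrix_apply_ne _ _ _ (by simp [hne]), Matrix.blockDiagonal'_apply_ne _ _ _ hne]
    simp
  rw [Matrix.charpoly, ht.det_fintype]
  refine Finset.prod_congr rfl fun i _ => ?_
  rw [Matrix.charpoly, ← Matrix.det_submatrix_equiv_self (Equiv.sigmaSubtype i).symm]
  congr 1
  ext1 a b
  simp [Matrix.toSquareBlock_def, Matrix.charmatrix_apply, Matrix.diagonal_apply,
    Equiv.sigmaSubtype]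

/-- The companion matrix of a polynomial. -/
noncomputable def companionMatrix {F : Type*} [Field F] (p : Polynomial F) :
    Matrix (Fin p.natDegree) (Fin p.natDegree) F :=
  Matrix.of fun i j => if (j : ℕ) + 1 = p.natDegree then -p.coeff i
    else if (i : ℕ) = j + 1 then 1 else 0

theorem charpoly_companionMatrix {F : Type*} [Field F] {p : Polynomial F} (hp : p.Monic) :
    (companionMatrix p).charpoly = p := by
  have hmin : minpoly F (AdjoinRoot.powerBasis' hp).gen = p := by
    change minpoly F (AdjoinRoot.root p) = p
    rw [AdjoinRoot.minpoly_root hp.ne_zero, hp.leadingCoeff]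
    simp
  have h : companionMatrix p = Algebra.leftMulMatrix (AdjoinRoot.powerBasis' hp).basis
      (AdjoinRoot.powerBasis' hp).gen := by
    rw [PowerBasis.leftMulMatrix, PowerBasis.minpolyGen_eq, hmin]
    rfl
  rw [h]
  exact (charpoly_leftMulMatrix _).trans hmin

theorem toMatrix_eq_blockDiagonal'_companionMatrix {F V ι : Type*} [Field F] [AddCommGroup V]
    [Module F V] [Fintype ι] [DecidableEq ι] (T : Module.End F V) (p : ι → Polynomial F)
    (hp : ∀ i, (p i).Monic) (g : ι → V) (hg : ∀ i, Polynomial.aeval T (p i) (g i) = 0)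
    (b : Module.Basis (Σ i, Fin (p i).natDegree) F V) (hb : ∀ x, b x = (T ^ (x.2 : ℕ)) (g x.1)) :
    LinearMap.toMatrix b b T = Matrix.blockDiagonal' fun i => companionMatrix (p i) := by
  ext ⟨i', a'⟩ ⟨i, a⟩
  rw [LinearMap.toMatrix_apply]
  have hstep : T (b ⟨i, a⟩) = (T ^ (a + 1 : ℕ)) (g i) := by
    rw [hb, pow_succ', Module.End.mul_apply]
  by_cases ha : (a : ℕ) + 1 = (p i).natDegree
  · have hlast : T (b ⟨i, a⟩) = ∑ c : Fin (p i).natDegree, (-(p i).coeff c) • b ⟨i, c⟩ := by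
      have h0 := hg i
      rw [Polynomial.aeval_eq_sum_range, Finset.sum_range_succ, (hp i).coeff_natDegree, one_smul,
        LinearMap.add_apply, ← ha, ← hstep, LinearMap.sum_apply, ha,
        Finset.sum_range] at h0
      rw [eq_neg_of_add_eq_zero_right h0, ← Finset.sum_neg_distrib]
      exact Finset.sum_congr rfl fun c _ => by simp [hb]
    rw [hlast, map_sum, Finset.sum_apply']
    by_cases hi : i' = i
    · subst hi
      rw [Matrix.blockDiagonal'_apply_eq]
      simp [companionMatrix, ha, Finsupp.single_apply]
    · rw [Matrix.blockDiagonal'_apply_ne _ _ _ hi]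
      refine Finset.sum_eq_zero fun c _ => ?_
      simp [Ne.symm hi]
  · have hlt : (a : ℕ) + 1 < (p i).natDegree := lt_of_le_of_ne a.2 ha
    have hnext : T (b ⟨i, a⟩) = b ⟨i, ⟨a + 1, hlt⟩⟩ := by rw [hstep, hb]
    rw [hnext, Module.Basis.repr_self]
    by_cases hi : i' = i
    · subst hi
      rw [Matrix.blockDiagonal'_apply_eq]
      simp [companionMatrix, ha, Finsupp.single_apply, Fin.ext_iff, eq_comm]
    · rw [Matrix.blockDiagonal'_apply_ne _ _ _ hi]
      simp [Ne.symm hi]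

/-- Replacing the last `r` companion blocks by a single one changes at most `r` columns. -/
theorem exists_matrix_charpoly_of_companion {F : Type*} [Field F] {k r : ℕ}
    (p : Fin k ⊕ Fin r → Polynomial F) (hp : ∀ i, (p i).Monic) (β : Polynomial F) (hβ : β.Monic)
    (hdeg : β.natDegree = ∑ j, (p (Sum.inr j)).natDegree) :
    ∃ C : Matrix (Σ i, Fin (p i).natDegree) (Σ i, Fin (p i).natDegree) F,
      C.charpoly = (∏ j, p (Sum.inl j)) * β ∧
      ∃ s : Finset (Σ i, Fin (p i).natDegree), s.card ≤ r ∧ ∀ x ∉ s, ∀ y,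
        C y x = (Matrix.blockDiagonal' fun i => companionMatrix (p i)) y x := by
  let σ : (Σ i, Fin (p i).natDegree) ≃
      (Σ j : Fin k, Fin (p (Sum.inl j)).natDegree) ⊕ Fin β.natDegree :=
    (Equiv.sumSigmaDistrib fun i => Fin (p i).natDegree).trans
      (Equiv.sumCongr (Equiv.refl _) (finSigmaFinEquiv.trans (finCongr hdeg.symm)))
  let C := Matrix.fromBlocks (Matrix.blockDiagonal' fun j => companionMatrix (p (Sum.inl j))) 0 0
    (companionMatrix β)
  have hσ : ∀ j (c : Fin (p (Sum.inr j)).natDegree), ∃ h, σ ⟨Sum.inr j, c⟩ =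
      Sum.inr ⟨finSigmaFinEquiv (⟨j, c⟩ : Σ j, Fin (p (Sum.inr j)).natDegree), h⟩ := fun j c =>
    ⟨(Fin.is_lt (finSigmaFinEquiv (⟨j, c⟩ : Σ j, Fin (p (Sum.inr j)).natDegree))).trans_eq
      hdeg.symm, rfl⟩
  have hσl : ∀ j (c : Fin (p (Sum.inl j)).natDegree), σ ⟨Sum.inl j, c⟩ = Sum.inl ⟨j, c⟩ :=
    fun j c => rfl
  refine ⟨C.submatrix σ σ, ?_, Finset.univ.filter fun x => ∃ j, x.1 = Sum.inr j ∧
    (x.2 : ℕ) + 1 = (p x.1).natDegree, ?_, ?_⟩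
  · refine (Matrix.charpoly_reindex σ.symm C).trans ?_
    rw [Matrix.charpoly_fromBlocks_zero₁₂, charpoly_blockDiagonal', charpoly_companionMatrix hβ]
    simp only [charpoly_companionMatrix (hp _)]
  · refine (Finset.card_le_card_of_injOn (t := Finset.univ.map Function.Embedding.inr)
      (fun x => x.1) ?_ ?_).trans_eq (by simp)
    · intro x hx
      obtain ⟨j, hj, -⟩ := (Finset.mem_filter.1 hx).2
      simp [hj]
    · rintro ⟨i, c⟩ hx ⟨i', c'⟩ hx' (rfl : i = i')
      obtain ⟨-, -, h⟩ := (Finset.mem_filter.1 hx).2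
      obtain ⟨-, -, h'⟩ := (Finset.mem_filter.1 hx').2
      simp only at h h'
      have : c = c' := Fin.ext (by omega)
      rw [this]
  · rintro ⟨i | j, c⟩ hx ⟨i' | j', c'⟩
    · simp only [Matrix.submatrix_apply, hσl, C, Matrix.fromBlocks_apply₁₁]
      by_cases h : i' = i
      · subst h
        rw [Matrix.blockDiagonal'_apply_eq, Matrix.blockDiagonal'_apply_eq]
      · rw [Matrix.blockDiagonal'_apply_ne _ _ _ h, Matrix.blockDiagonal'_apply_ne]
        simpa using h
    · obtain ⟨h, h'⟩ := hσ j' c'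
      rw [Matrix.submatrix_apply, hσl, h', Matrix.blockDiagonal'_apply_ne _ _ _ (by simp)]
      rfl
    · obtain ⟨h, h'⟩ := hσ j c
      rw [Matrix.submatrix_apply, hσl, h', Matrix.blockDiagonal'_apply_ne _ _ _ (by simp)]
      rfl
    · have hne : (c : ℕ) + 1 ≠ (p (Sum.inr j)).natDegree := fun h => hx (by simp [h])
      have hlt : (c : ℕ) + 1 < (p (Sum.inr j)).natDegree := lt_of_le_of_ne c.2 hne
      have hsucc : (finSigmaFinEquiv (⟨j, ⟨c + 1, hlt⟩⟩ : Σ j, Fin (p (Sum.inr j)).natDegree) : ℕ) =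
          (finSigmaFinEquiv (⟨j, c⟩ : Σ j, Fin (p (Sum.inr j)).natDegree) : ℕ) + 1 := by
        rw [finSigmaFinEquiv_apply, finSigmaFinEquiv_apply, add_assoc]
      obtain ⟨h, h'⟩ := hσ j c
      obtain ⟨h2, h2'⟩ := hσ j' c'
      obtain ⟨h3, -⟩ := hσ j ⟨c + 1, hlt⟩
      rw [Matrix.submatrix_apply, h', h2']
      change companionMatrix β _ _ = _
      have hn : (finSigmaFinEquiv (⟨j, c⟩ : Σ j, Fin (p (Sum.inr j)).natDegree) : ℕ) + 1 ≠
          β.natDegree := by omega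
      rw [companionMatrix, Matrix.of_apply, if_neg (by simpa using hn)]
      have hiff : (finSigmaFinEquiv (⟨j', c'⟩ : Σ j, Fin (p (Sum.inr j)).natDegree) : ℕ) =
          (finSigmaFinEquiv (⟨j, c⟩ : Σ j, Fin (p (Sum.inr j)).natDegree) : ℕ) + 1 ↔
          (⟨j', c'⟩ : Σ j, Fin (p (Sum.inr j)).natDegree) = ⟨j, ⟨c + 1, hlt⟩⟩ := by
        rw [← hsucc, ← Fin.ext_iff, finSigmaFinEquiv.apply_eq_iff_eq]
      simp only [hiff]
      by_cases hj : j' = j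
      · subst hj
        rw [Matrix.blockDiagonal'_apply_eq, companionMatrix, Matrix.of_apply, if_neg hne]
        simp [Fin.ext_iff]
      · rw [Matrix.blockDiagonal'_apply_ne _ _ _ (by simpa using hj), if_neg (by simp [hj])]

/-- The evaluation map `F[X]ⁿ → Fⁿ` for the `F[X]`-module structure given by `T`. -/
noncomputable def polyEval {F : Type*} [Field F] {n : ℕ} (T : Module.End F (Fin n → F))
    (v : Fin n → Polynomial F) : Fin n → F :=
  ∑ i, Polynomial.aeval T (v i) (Pi.single i 1)

theorem polyEval_smul {F : Type*} [Field F] {n : ℕ} (T : Module.End F (Fin n → F))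
    (p : Polynomial F) (v : Fin n → Polynomial F) :
    polyEval T (p • v) = Polynomial.aeval T p (polyEval T v) := by
  simp [polyEval, map_sum]

theorem polyEval_sum {F ι : Type*} [Field F] {n : ℕ} (T : Module.End F (Fin n → F))
    (s : Finset ι) (v : ι → Fin n → Polynomial F) :
    polyEval T (∑ j ∈ s, v j) = ∑ j ∈ s, polyEval T (v j) := by
  simp only [polyEval, Finset.sum_apply, map_sum, LinearMap.sum_apply]
  exact Finset.sum_comm

theorem polyEval_C {F : Type*} [Field F] {n : ℕ} (T : Module.End F (Fin n → F))
    (c : Fin n → F) : polyEval T (fun i => Polynomial.C (c i)) = c := by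
  simp only [polyEval, Polynomial.aeval_C, Module.algebraMap_end_apply]
  ext j
  simp [Finset.sum_apply, Pi.single_apply]

theorem polyEval_charmatrix_mulVec {F : Type*} [Field F] {n : ℕ} (M : Matrix (Fin n) (Fin n) F)
    (w : Fin n → Polynomial F) :
    polyEval (Matrix.toLin' M) (M.charmatrix.mulVec w) = 0 := by
  have h1 : M.charmatrix.mulVec w = ∑ j, w j • fun i => M.charmatrix i j := by
    ext i
    simp [Matrix.mulVec, dotProduct, Finset.sum_apply, mul_comm]
  rw [h1, polyEval_sum]
  refine Finset.sum_eq_zero fun j _ => ?_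
  rw [polyEval_smul]
  have h0 : polyEval (Matrix.toLin' M) (fun i => M.charmatrix i j) = 0 := by
    simp only [polyEval, Matrix.charmatrix_apply, map_sub, LinearMap.sub_apply,
      Finset.sum_sub_distrib, Polynomial.aeval_C, Module.algebraMap_end_apply]
    rw [Finset.sum_eq_single j (fun i _ hi => by simp [hi]) (by simp)]
    ext i
    simp [Finset.sum_apply, Pi.single_apply]
  rw [h0, map_zero]

theorem exists_charpoly_perturbation {F : Type*} [Field F] {k r : ℕ}
    (M : Matrix (Fin (k + r)) (Fin (k + r)) F) (q : Polynomial F) (hq : q.Monic)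
    (hqd : q.natDegree = k + r)
    (hdvd : ∀ e : Polynomial F, (∀ ri ci : Fin k → Fin (k + r),
      e ∣ (M.charmatrix.submatrix ri ci).det) → e ∣ q) :
    ∃ K : Matrix (Fin (k + r)) (Fin (k + r)) F,
      (K.map (algebraMap F (RatFunc F))).rank ≤ r ∧ (M + K).charpoly = q := by
  obtain ⟨d, ⟨U, V, hU, hV, hUV⟩, hd⟩ := exists_smith _ M.charmatrix
  obtain ⟨U', hU1, hU2⟩ := isUnit_iff_exists.1 hU
  obtain ⟨V', hV1, hV2⟩ := isUnit_iff_exists.1 hV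
  have hM : M.charmatrix = U' * Matrix.diagonal d * V' := by
    rw [← hUV, mul_assoc U, ← mul_assoc U', hU2, one_mul, mul_assoc, hV1, mul_one]
  have hdet : Associated (∏ i, d i) M.charpoly := by
    have h := congrArg Matrix.det hUV
    rw [Matrix.det_mul, Matrix.det_mul, Matrix.det_diagonal] at h
    rw [← h]
    have hU := (Matrix.isUnit_iff_isUnit_det _).1 hU
    have hV := (Matrix.isUnit_iff_isUnit_det _).1 hV
    exact (associated_mul_unit_left _ _ hV).trans (associated_unit_mul_left _ _ hU)
  have hd0 : ∀ i, d i ≠ 0 := by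
    intro i hi
    exact hdet.ne_zero_iff.2 M.charpoly_monic.ne_zero
      (Finset.prod_eq_zero (Finset.mem_univ i) hi)
  let p : Fin k ⊕ Fin r → Polynomial F := fun x =>
    d (finSumFinEquiv x) * Polynomial.C (d (finSumFinEquiv x)).leadingCoeff⁻¹
  have hp : ∀ x, (p x).Monic := fun x => Polynomial.monic_mul_leadingCoeff_inv (hd0 _)
  have hpd : ∀ x, Associated (p x) (d (finSumFinEquiv x)) := fun x =>
    associated_mul_unit_left _ _
      (Polynomial.isUnit_C.2 (by simpa using hd0 (finSumFinEquiv x)))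
  have hsum : ∑ x, (p x).natDegree = k + r := by
    have h1 : Associated (∏ x, p x) M.charpoly := by
      refine Associated.trans ?_ hdet
      rw [← finSumFinEquiv.prod_comp d]
      exact Associated.prod _ _ _ fun x _ => hpd x
    have h2 := Polynomial.natDegree_eq_of_degree_eq (Polynomial.degree_eq_degree_of_associated h1)
    rw [Polynomial.natDegree_prod _ _ fun x _ => (hp x).ne_zero, M.charpoly_natDegree_eq_dim,
      Fintype.card_fin] at h2
    exact h2
  -- the cofactor
  obtain ⟨β, hβ⟩ : (∏ j : Fin k, p (Sum.inl j)) ∣ q := by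
    refine (Finset.prod_dvd_prod_of_dvd _ _ fun j _ => (hpd (Sum.inl j)).dvd).trans ?_
    refine hdvd _ fun ri ci => ?_
    rw [hM]
    refine dvd_det_submatrix_mul_right _ _ (dvd_det_submatrix_mul_left _ _ fun ri ci => ?_) ri ci
    exact prod_dvd_det_submatrix_diagonal (Nat.le_add_right k r) d hd ri ci
  have hmon : (∏ j : Fin k, p (Sum.inl j)).Monic := Polynomial.monic_prod_of_monic _ _ fun _ _ => hp _
  have hβm : β.Monic := hmon.of_mul_monic_left (hβ ▸ hq)
  have hβd : β.natDegree = ∑ j, (p (Sum.inr j)).natDegree := by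
    have h1 := congrArg Polynomial.natDegree hβ
    rw [hmon.natDegree_mul hβm, Polynomial.natDegree_prod _ _ fun x _ => (hp _).ne_zero, hqd,
      ← hsum, Fintype.sum_sum_type] at h1
    omega
  -- the Krylov basis
  set T := Matrix.toLin' M with hT
  let f : Fin (k + r) → Fin (k + r) → Polynomial F := fun j i =>
    U' i j
  let g : Fin k ⊕ Fin r → Fin (k + r) → F := fun x => polyEval T (f (finSumFinEquiv x))
  have hg : ∀ x, Polynomial.aeval T (p x) (g x) = 0 := by
    intro x
    have h0 : d (finSumFinEquiv x) • f (finSumFinEquiv x) =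
        M.charmatrix.mulVec fun i => V i (finSumFinEquiv x) := by
      have : M.charmatrix * V = U' * Matrix.diagonal d := by
        rw [← hUV, mul_assoc U, ← mul_assoc U', hU2, one_mul]
      ext1 i
      have h2 := congrFun (congrFun this i) (finSumFinEquiv x)
      rw [Matrix.mul_diagonal] at h2
      rw [Pi.smul_apply, smul_eq_mul, mul_comm]
      exact h2.symm
    have h1 : Polynomial.aeval T (d (finSumFinEquiv x)) (g x) = 0 := by
      rw [← polyEval_smul, h0, polyEval_charmatrix_mulVec]
    change Polynomial.aeval T (d _ * Polynomial.C _) (g x) = 0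
    rw [mul_comm, map_mul, Module.End.mul_apply, h1, map_zero]
  let fam : (Σ x, Fin (p x).natDegree) → Fin (k + r) → F := fun x => (T ^ (x.2 : ℕ)) (g x.1)
  have hcyc : ∀ (x) (w : Polynomial F), Polynomial.aeval T w (g x) ∈
      Submodule.span F (Set.range fam) := by
    intro x w
    rw [← Polynomial.modByMonic_add_div w (p x), mul_comm, map_add, map_mul, LinearMap.add_apply,
      Module.End.mul_apply, hg, map_zero, add_zero]
    by_cases hpx : p x = 1
    · simp [hpx]
    rw [Polynomial.aeval_eq_sum_range' (Polynomial.natDegree_modByMonic_lt _ (hp x) hpx),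
      LinearMap.sum_apply]
    refine Submodule.sum_mem _ fun i hi => ?_
    rw [LinearMap.smul_apply]
    exact Submodule.smul_mem _ _ (Submodule.subset_span ⟨⟨x, i, Finset.mem_range.1 hi⟩, rfl⟩)
  have hspan : ⊤ ≤ Submodule.span F (Set.range fam) := by
    rintro c -
    set w : Fin (k + r) → Polynomial F := fun i => Polynomial.C (c i) with hwc
    have hw : w = ∑ x, (U.mulVec w) (finSumFinEquiv x) •
        f (finSumFinEquiv x) := by
      rw [finSumFinEquiv.sum_comp
        (fun j => (U.mulVec w) j • f j)]
      have h1 : w = U'.mulVec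
          (U.mulVec w) := by
        rw [Matrix.mulVec_mulVec, hU2, Matrix.one_mulVec]
      conv_lhs => rw [h1]
      generalize (U.mulVec w) = z
      ext1 i
      simp [Matrix.mulVec, dotProduct, f, mul_comm]
    rw [← polyEval_C T c]
    change polyEval T w ∈ _
    rw [hw, polyEval_sum]
    refine Submodule.sum_mem _ fun x _ => ?_
    rw [polyEval_smul]
    exact hcyc x _
  let b := basisOfTopLeSpanOfCardEqFinrank fam hspan (by simp [hsum])
  have hb : ∀ x, b x = (T ^ (x.2 : ℕ)) (g x.1) := fun x => by
    simp [b, fam]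
  have hTb := toMatrix_eq_blockDiagonal'_companionMatrix T p hp g hg b hb
  obtain ⟨C, hC, s, hs, hCs⟩ := exists_matrix_charpoly_of_companion p hp β hβm hβd
  let N := C - LinearMap.toMatrix b b T
  let e := Pi.basisFun F (Fin (k + r))
  refine ⟨e.toMatrix b * N * b.toMatrix e, ?_, ?_⟩
  · rw [Matrix.map_mul, Matrix.map_mul]
    refine (Matrix.rank_mul_le_left _ _).trans ((Matrix.rank_mul_le_right _ _).trans ?_)
    rw [← Matrix.rank_transpose]
    refine (Matrix.rank_le_card_of_support_subset _ s ?_).trans hs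
    intro x hx
    by_contra hxs
    apply hx
    ext y
    simp [N, hTb, hCs x hxs y]
  · have h1 : M = e.toMatrix b * LinearMap.toMatrix b b T * b.toMatrix e := by
      rw [basis_toMatrix_mul_linearMap_toMatrix_mul_basis_toMatrix]
      simp [e, hT]
    have h2 : M + e.toMatrix b * N * b.toMatrix e =
        LinearMap.toMatrix e e (Matrix.toLin b b C) := by
      rw [← basis_toMatrix_mul_linearMap_toMatrix_mul_basis_toMatrix e b e b,
        LinearMap.toMatrix_toLin]
      conv_lhs => rw [h1]
      simp only [N, Matrix.mul_sub, Matrix.sub_mul]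
      abel
    rw [h2, LinearMap.charpoly_toMatrix, ← LinearMap.charpoly_toMatrix _ b,
      LinearMap.toMatrix_toLin, hC, ← hβ]

/-- Adding `u wᵀ` raises the rank by one when `u` is outside the column space and `w` outside the
row space. -/
theorem rank_add_vecMulVec_eq {K : Type*} [Field K] {n : ℕ} (P : Matrix (Fin n) (Fin n) K)
    (u w x y : Fin n → K) (hx : P.mulVec x = 0) (hy : Matrix.vecMul y P = 0)
    (hwx : w ⬝ᵥ x ≠ 0) (hyu : y ⬝ᵥ u ≠ 0) :
    (P + Matrix.vecMulVec u w).rank = P.rank + 1 := by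
  have hu : u ∉ LinearMap.range P.mulVecLin := by
    rintro ⟨z, rfl⟩
    apply hyu
    rw [Matrix.mulVecLin_apply, Matrix.dotProduct_mulVec, hy, zero_dotProduct]
  have happ : ∀ z, (P + Matrix.vecMulVec u w).mulVec z = P.mulVec z + (w ⬝ᵥ z) • u := by
    intro z
    rw [Matrix.add_mulVec, Matrix.vecMulVec_mulVec]
    simp
  have hr : LinearMap.range (P + Matrix.vecMulVec u w).mulVecLin =
      LinearMap.range P.mulVecLin ⊔ Submodule.span K {u} := by
    apply le_antisymm
    · rintro _ ⟨z, rfl⟩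
      rw [Matrix.mulVecLin_apply, happ]
      exact Submodule.add_mem_sup ⟨z, rfl⟩
        (Submodule.smul_mem _ _ (Submodule.mem_span_singleton_self u))
    · have hmem : u ∈ LinearMap.range (P + Matrix.vecMulVec u w).mulVecLin := by
        refine ⟨(w ⬝ᵥ x)⁻¹ • x, ?_⟩
        rw [Matrix.mulVecLin_apply, Matrix.mulVec_smul, happ, hx, zero_add, inv_smul_smul₀ hwx]
      refine sup_le ?_ ((Submodule.span_singleton_le_iff_mem _ _).2 hmem)
      rintro _ ⟨z, rfl⟩
      have : P.mulVec z = (P + Matrix.vecMulVec u w).mulVec z - (w ⬝ᵥ z) • u := by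
        rw [happ, add_sub_cancel_right]
      rw [Matrix.mulVecLin_apply, this]
      exact Submodule.sub_mem _ ⟨z, rfl⟩ (Submodule.smul_mem _ _ hmem)
  rw [Matrix.rank, hr, Matrix.rank]
  have hu0 : u ≠ 0 := by
    rintro rfl
    simp at hyu
  have hdisj : LinearMap.range P.mulVecLin ⊓ Submodule.span K {u} = ⊥ := by
    rw [← disjoint_iff, Submodule.disjoint_span_singleton' hu0]
    exact hu
  have := Submodule.finrank_sup_add_finrank_inf_eq (LinearMap.range P.mulVecLin)
    (Submodule.span K {u})
  rw [hdisj, finrank_bot, finrank_span_singleton hu0] at this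
  simpa using this

/-- For two nonzero functionals there are orthogonal integral vectors on which they do not
vanish. -/
theorem exists_orthogonal_detecting {F K : Type*} [Field F] [Field K] [Algebra F K] {n : ℕ}
    (hn : 2 ≤ n) (y z : Fin n → K) (hy : y ≠ 0) (hz : z ≠ 0) :
    ∃ u v : Fin n → F, v ⬝ᵥ u = 0 ∧ y ⬝ᵥ (fun i => algebraMap F K (u i)) ≠ 0 ∧
      (fun i => algebraMap F K (v i)) ⬝ᵥ z ≠ 0 := by
  have hs : ∀ (i : Fin n) (a : F), (fun l => algebraMap F K ((Pi.single i a : Fin n → F) l)) =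
      Pi.single i (algebraMap F K a) := by
    intro i a
    ext l
    by_cases h : l = i
    · subst h; simp
    · simp [h]
  obtain ⟨i, hi⟩ := Function.ne_iff.1 hy
  obtain ⟨j, hj⟩ := Function.ne_iff.1 hz
  have key : ∀ i j, i ≠ j → y i ≠ 0 → z j ≠ 0 → ∃ u v : Fin n → F, v ⬝ᵥ u = 0 ∧
      y ⬝ᵥ (fun i => algebraMap F K (u i)) ≠ 0 ∧ (fun i => algebraMap F K (v i)) ⬝ᵥ z ≠ 0 := by
    intro i j hij hi hj
    refine ⟨Pi.single i 1, Pi.single j 1, ?_, ?_, ?_⟩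
    · simp [hij.symm]
    · simpa [hs] using hi
    · simpa [hs] using hj
  by_cases hij : i = j
  · subst hij
    have : Nontrivial (Fin n) := Fin.nontrivial_iff_two_le.2 hn
    obtain ⟨k, hk⟩ := exists_ne i
    by_cases hyk : y k = 0
    · by_cases hzk : z k = 0
      · refine ⟨Pi.single i 1 + Pi.single k 1, Pi.single i 1 - Pi.single k 1, ?_, ?_, ?_⟩
        · simp [hk, hk.symm]
        · have : (fun l => algebraMap F K ((Pi.single i 1 + Pi.single k 1 : Fin n → F) l)) =
              Pi.single i 1 + Pi.single k 1 := by
            ext l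
            have h1 := congrFun (hs i 1) l
            have h2 := congrFun (hs k 1) l
            simp only [map_one] at h1 h2
            rw [Pi.add_apply, Pi.add_apply, map_add, h1, h2]
          rw [this]
          simpa [hyk] using hi
        · have : (fun l => algebraMap F K ((Pi.single i 1 - Pi.single k 1 : Fin n → F) l)) =
              Pi.single i 1 - Pi.single k 1 := by
            ext l
            have h1 := congrFun (hs i 1) l
            have h2 := congrFun (hs k 1) l
            simp only [map_one] at h1 h2
            rw [Pi.sub_apply, Pi.sub_apply, map_sub, h1, h2]
          rw [this]
          simpa [sub_dotProduct, hzk] using hj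
      · exact key i k hk.symm hi hzk
    · exact key k i hk hyk hj
  · exact key i j hij hi hj

theorem pencilOf_eq_mul_charmatrix {F : Type*} [Field F] {n : ℕ} (G₀ G₁ : Matrix (Fin n) (Fin n) F)
    (hG : IsUnit G₁.det) :
    pencilOf G₀ G₁ = G₁.map Polynomial.C * (-(G₁⁻¹ * G₀)).charmatrix := by
  have h1 : G₁.map Polynomial.C * (G₁⁻¹ * G₀).map Polynomial.C = G₀.map Polynomial.C := by
    rw [← Matrix.map_mul, Matrix.mul_nonsing_inv_cancel_left _ _ hG]
  have h2 : (-(G₁⁻¹ * G₀)).charmatrix = (Polynomial.X : Polynomial F) • 1 +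
      (G₁⁻¹ * G₀).map Polynomial.C := by
    generalize G₁⁻¹ * G₀ = G
    ext i j : 2
    simp [Matrix.charmatrix_apply, Matrix.one_apply, Matrix.diagonal_apply]
  rw [h2, mul_add, h1, Matrix.mul_smul, mul_one, add_comm, pencilOf]

theorem exists_det_pencilOf_perturbation {F : Type*} [Field F] {k r : ℕ}
    (G₀ G₁ : Matrix (Fin (k + r)) (Fin (k + r)) F) (hG : IsUnit G₁.det) (q : Polynomial F)
    (hq0 : q ≠ 0) (hqd : q.natDegree = k + r)
    (hdvd : ∀ e : Polynomial F, (∀ ri ci : Fin k → Fin (k + r),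
      e ∣ ((pencilOf G₀ G₁).submatrix ri ci).det) → e ∣ q) :
    ∃ (K : Matrix (Fin (k + r)) (Fin (k + r)) F) (u : F), u ≠ 0 ∧
      (K.map (algebraMap F (RatFunc F))).rank ≤ r ∧
      (pencilOf (G₀ + K) G₁).det = Polynomial.C u * q := by
  have hlc : q.leadingCoeff ≠ 0 := Polynomial.leadingCoeff_ne_zero.2 hq0
  obtain ⟨K, hK, hKq⟩ := exists_charpoly_perturbation (-(G₁⁻¹ * G₀))
    (q * Polynomial.C q.leadingCoeff⁻¹) (Polynomial.monic_mul_leadingCoeff_inv hq0)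
    (by rw [Polynomial.natDegree_mul_C (inv_ne_zero hlc), hqd]) (by
      intro e he
      refine Dvd.dvd.mul_right (hdvd e fun ri ci => ?_) _
      rw [pencilOf_eq_mul_charmatrix G₀ G₁ hG]
      exact dvd_det_submatrix_mul_left _ _ he ri ci)
  refine ⟨-(G₁ * K), G₁.det * q.leadingCoeff⁻¹, mul_ne_zero hG.ne_zero (inv_ne_zero hlc), ?_, ?_⟩
  · rw [← Matrix.neg_mul, Matrix.map_mul]
    exact (Matrix.rank_mul_le_right _ _).trans hK
  · have h : -(G₁⁻¹ * (G₀ + -(G₁ * K))) = -(G₁⁻¹ * G₀) + K := by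
      rw [mul_add, mul_neg, Matrix.nonsing_inv_mul_cancel_left _ _ hG]
      abel
    rw [pencilOf_eq_mul_charmatrix _ _ hG, h, Matrix.det_mul, ← Matrix.charpoly, hKq, map_mul]
    have : (G₁.map Polynomial.C).det = Polynomial.C G₁.det := (RingHom.map_det _ _).symm
    rw [this]
    ring

open MvPolynomial in
theorem isHomogeneous_det {R σ : Type*} [CommRing R] {n : ℕ}
    (M : Matrix (Fin n) (Fin n) (MvPolynomial σ R)) (hM : ∀ i j, (M i j).IsHomogeneous 1) :
    M.det.IsHomogeneous n := by
  rw [Matrix.det_apply]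
  refine IsHomogeneous.sum _ _ _ fun g _ => ?_
  rw [Units.smul_def, zsmul_eq_mul]
  have h := IsHomogeneous.prod Finset.univ (fun i => M (g i) i) (fun _ => 1) fun i _ => hM _ _
  simp only [Finset.sum_const, Finset.card_univ, Fintype.card_fin, smul_eq_mul, mul_one] at h
  have h2 := (isHomogeneous_C σ (((Equiv.Perm.sign g : ℤˣ) : ℤ) : R)).mul h
  simpa using h2

theorem isHomogeneous_homPencil {F : Type*} [Field F] {m n : ℕ} (G₀ G₁ : Matrix (Fin m) (Fin n) F)
    (i : Fin m) (j : Fin n) : (homPencil G₀ G₁ i j).IsHomogeneous 1 := by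
  have h := fun (x : Fin 2) (a : F) =>
    (MvPolynomial.isHomogeneous_X F x).mul (MvPolynomial.isHomogeneous_C (Fin 2) a)
  exact (h 1 (G₀ i j)).add (h 0 (G₁ i j))

theorem map_aeval_homPencil {F : Type*} [Field F] {m n : ℕ} (G₀ G₁ : Matrix (Fin m) (Fin n) F) :
    (homPencil G₀ G₁).map (MvPolynomial.aeval (![Polynomial.X, 1] : Fin 2 → Polynomial F)) =
      pencilOf G₀ G₁ := by
  ext i j : 2
  simp [homPencil, pencilOf]

theorem aeval_det_submatrix_homPencil {F : Type*} [Field F] {m n k : ℕ}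
    (G₀ G₁ : Matrix (Fin m) (Fin n) F) (ri : Fin k → Fin m) (ci : Fin k → Fin n) :
    MvPolynomial.aeval (![Polynomial.X, 1] : Fin 2 → Polynomial F)
      ((homPencil G₀ G₁).submatrix ri ci).det = ((pencilOf G₀ G₁).submatrix ri ci).det := by
  rw [AlgHom.map_det, ← map_aeval_homPencil]
  rfl

theorem natDegree_aeval_le_of_isHomogeneous {R : Type*} [CommRing R] {n : ℕ}
    {p : MvPolynomial (Fin 2) R} (hp : p.IsHomogeneous n) :
    (MvPolynomial.aeval (![Polynomial.X, 1] : Fin 2 → Polynomial R) p).natDegree ≤ n := by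
  rw [p.as_sum, MvPolynomial.aeval_sum]
  refine Polynomial.natDegree_sum_le_of_forall_le _ _ fun m hm => ?_
  obtain rfl : m.weight 1 = n := hp <| by simpa using hm
  rw [MvPolynomial.aeval_monomial]
  refine (Polynomial.natDegree_C_mul_le _ _).trans ?_
  simp only [Finsupp.prod_fintype, Finsupp.weight_apply, Finsupp.sum_fintype, Fin.prod_univ_two,
    Fin.sum_univ_two, pow_zero, implies_true, Matrix.cons_val_zero, Matrix.cons_val_one, one_pow,
    mul_one, Pi.one_apply, smul_eq_mul]
  exact (Polynomial.natDegree_X_pow_le _).trans (Nat.le_add_right _ _)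

theorem eq_of_aeval_eq_of_isHomogeneous {R : Type*} [CommRing R] {n : ℕ}
    {p q : MvPolynomial (Fin 2) R} (hp : p.IsHomogeneous n) (hq : q.IsHomogeneous n)
    (h : MvPolynomial.aeval (![Polynomial.X, 1] : Fin 2 → Polynomial R) p =
      MvPolynomial.aeval (![Polynomial.X, 1] : Fin 2 → Polynomial R) q) : p = q := by
  rw [← Polynomial.homogenize_eq_of_isHomogeneous hp rfl, h,
    Polynomial.homogenize_eq_of_isHomogeneous hq rfl]

theorem homogenize_eq_mul_X_pow {R : Type*} [CommRing R] {n : ℕ} (p : Polynomial R)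
    (hp : p.natDegree ≤ n) :
    p.homogenize n = p.homogenize p.natDegree * MvPolynomial.X 1 ^ (n - p.natDegree) := by
  have h := Polynomial.homogenize_mul p 1 (le_refl p.natDegree)
    (n := n - p.natDegree) (by simp)
  rwa [mul_one, Nat.add_sub_cancel' hp, Polynomial.homogenize_one] at h

/-- A homogeneous divisor of `Φ` divides the homogenization of `q` in degree `n` as soon as the
dehomogenization of `Φ` divides `q` and `t` occurs in `Φ` at most `n - deg q` times. -/
theorem dvd_homogenize_of_dvd {F : Type*} [Field F] {n h : ℕ} {H Φ : MvPolynomial (Fin 2) F}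
    {q : Polynomial F} (hqn : q.natDegree ≤ n) (hH : H.IsHomogeneous h) (hHΦ : H ∣ Φ)
    (hΦ : MvPolynomial.aeval (![Polynomial.X, 1] : Fin 2 → Polynomial F) Φ ∣ q)
    (hX : ∀ a, MvPolynomial.X 1 ^ a ∣ Φ → a ≤ n - q.natDegree) :
    H ∣ q.homogenize n := by
  obtain ⟨w, hw⟩ := (map_dvd _ hHΦ).trans hΦ
  have hp := natDegree_aeval_le_of_isHomogeneous hH
  have hpH := Polynomial.homogenize_eq_of_isHomogeneous hH rfl
  set p := MvPolynomial.aeval (![Polynomial.X, 1] : Fin 2 → Polynomial F) H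
  rw [homogenize_eq_mul_X_pow p hp] at hpH
  have ha := hX _ ((Dvd.intro_left _ hpH).trans hHΦ)
  rw [homogenize_eq_mul_X_pow q hqn, ← hpH]
  exact mul_dvd_mul (Polynomial.homogenize_dvd ⟨w, hw⟩) (pow_dvd_pow _ ha)

theorem exists_perturbation_of_chart {F : Type*} [Field F] {k r : ℕ}
    {A₀ A₁ B₀ B₁ : Matrix (Fin (k + r)) (Fin (k + r)) F}
    (θ θ' : MvPolynomial (Fin 2) F →ₐ[F] MvPolynomial (Fin 2) F)
    (hθ : ∀ p d, p.IsHomogeneous d → (θ p).IsHomogeneous d)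
    (hθ' : ∀ p d, p.IsHomogeneous d → (θ' p).IsHomogeneous d)
    (hθθ' : ∀ p, θ' (θ p) = p) (hθ'θ : ∀ p, θ (θ' p) = p)
    (hB : (homPencil A₀ A₁).map θ = homPencil B₀ B₁) (hB₁ : IsUnit B₁.det)
    {q : Polynomial F} (hq : q ≠ 0) (hqn : q.natDegree ≤ k + r)
    (hqθ : (MvPolynomial.aeval (![Polynomial.X, 1] : Fin 2 → Polynomial F)
      (θ (q.homogenize (k + r)))).natDegree = k + r)
    (hdvd : ∀ (H : MvPolynomial (Fin 2) F) (h : ℕ), H.IsHomogeneous h →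
      (∀ ri ci : Fin k → Fin (k + r), H ∣ ((homPencil A₀ A₁).submatrix ri ci).det) →
      H ∣ q.homogenize (k + r)) :
    ∃ (K : Matrix (Fin (k + r)) (Fin (k + r)) F) (l : Polynomial F) (u : F), u ≠ 0 ∧
      (K.map (algebraMap F (RatFunc F))).rank ≤ r ∧ l.degree ≤ 1 ∧
      (pencilOf A₀ A₁ + l • K.map Polynomial.C).det = Polynomial.C u * q := by
  have hθQ := hθ _ _ (Polynomial.isHomogeneous_homogenize (n := k + r) q)
  have hdetB : ∀ G₀ G₁ : Matrix (Fin (k + r)) (Fin (k + r)) F, ∀ (d : ℕ) (ri ci : Fin d → Fin (k + r)),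
      ((homPencil G₀ G₁).submatrix ri ci).det.IsHomogeneous d := fun _ _ _ _ _ =>
    isHomogeneous_det _ fun _ _ => isHomogeneous_homPencil _ _ _ _
  obtain ⟨K, u, hu, hK, hdet⟩ := exists_det_pencilOf_perturbation B₀ B₁ hB₁ _ (by
      intro h0
      have h1 : θ (q.homogenize (k + r)) = 0 :=
        eq_of_aeval_eq_of_isHomogeneous hθQ (MvPolynomial.isHomogeneous_zero _ _ _)
          (by rw [h0, map_zero])
      have h2 := hθθ' (q.homogenize (k + r))
      rw [h1, map_zero] at h2
      exact hq (Polynomial.eq_zero_of_homogenize_eq_zero hqn h2.symm)) hqθ (by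
      intro e he
      have h1 : θ' (e.homogenize e.natDegree) ∣ q.homogenize (k + r) := by
        refine hdvd _ _ (hθ' _ _ (Polynomial.isHomogeneous_homogenize e)) fun ri ci => ?_
        rw [← hθθ' ((homPencil A₀ A₁).submatrix ri ci).det, AlgHom.map_det θ]
        refine map_dvd θ' ?_
        change _ ∣ (((homPencil A₀ A₁).map θ).submatrix ri ci).det
        rw [hB, ← Polynomial.homogenize_eq_of_isHomogeneous (hdetB B₀ B₁ k ri ci) rfl,
          homogenize_eq_mul_X_pow _ (natDegree_aeval_le_of_isHomogeneous (hdetB B₀ B₁ k ri ci))]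
        refine Dvd.dvd.mul_right (Polynomial.homogenize_dvd ?_) _
        rw [aeval_det_submatrix_homPencil]
        exact he ri ci
      have h2 := map_dvd (MvPolynomial.aeval (![Polynomial.X, 1] : Fin 2 → Polynomial F))
        (map_dvd θ h1)
      rwa [hθ'θ, Polynomial.aeval_homogenize_X_one _ le_rfl] at h2)
  have hdet' : (homPencil (B₀ + K) B₁).det =
      MvPolynomial.C u * θ (q.homogenize (k + r)) := by
    refine eq_of_aeval_eq_of_isHomogeneous (hdetB (B₀ + K) B₁ _ id id) ?_ ?_
    · simpa using (MvPolynomial.isHomogeneous_C (Fin 2) u).mul hθQ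
    · rw [AlgHom.map_det]
      change ((homPencil (B₀ + K) B₁).map _).det = _
      rw [map_aeval_homPencil, hdet, map_mul, MvPolynomial.aeval_C]
      rfl
  have hsplit : homPencil (B₀ + K) B₁ = (homPencil A₀ A₁).map θ +
      (MvPolynomial.X 1 : MvPolynomial (Fin 2) F) • K.map MvPolynomial.C := by
    rw [hB]
    simp only [homPencil, Matrix.map_add _ (map_add _), smul_add]
    abel
  refine ⟨K, MvPolynomial.aeval (![Polynomial.X, 1] : Fin 2 → Polynomial F)
    (θ' (MvPolynomial.X 1)), u, hu, hK, ?_, ?_⟩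
  · exact Polynomial.degree_le_of_natDegree_le (natDegree_aeval_le_of_isHomogeneous
      (hθ' _ _ (MvPolynomial.isHomogeneous_X F 1)))
  · have h1 := congrArg (fun p => MvPolynomial.aeval (![Polynomial.X, 1] : Fin 2 → Polynomial F)
      (θ' p)) hdet'
    simp only [map_mul, hθθ', Polynomial.aeval_homogenize_X_one _ hqn, MvPolynomial.algHom_C,
      AlgHom.map_det, AlgHom.commutes] at h1
    rw [← Polynomial.C_eq_algebraMap] at h1
    rw [← h1, hsplit, ← map_aeval_homPencil]
    congr 1
    ext i j : 2
    simp [hθθ']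

theorem exists_normalRank_succ {F : Type*} [Field F] {n : ℕ} (hn : 2 ≤ n)
    (A P : Matrix (Fin n) (Fin n) (Polynomial F)) (hA : IsPencil A) (hP : IsPencil P)
    (hdet : (A + P).det ≠ 0) (hrank : normalRank P < n) :
    ∃ P' : Matrix (Fin n) (Fin n) (Polynomial F), IsPencil P' ∧
      normalRank P' = normalRank P + 1 ∧ (A + P').det = (A + P).det := by
  let ι := algebraMap (Polynomial F) (RatFunc F)
  have hι : Function.Injective ι := IsFractionRing.injective _ _
  have hcomp : ∀ a, ι (Polynomial.C a) = algebraMap F (RatFunc F) a := fun a =>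
    (IsScalarTower.algebraMap_apply F (Polynomial F) (RatFunc F) a).symm
  have hsing : (P.map ι).det = 0 := by
    by_contra h
    have := Matrix.rank_of_isUnit (P.map ι) ((Matrix.isUnit_iff_isUnit_det _).2 (Ne.isUnit h))
    rw [Fintype.card_fin] at this
    exact hrank.ne this
  obtain ⟨x, hx0, hx⟩ := Matrix.exists_mulVec_eq_zero_iff.2 hsing
  obtain ⟨y, hy0, hy⟩ := Matrix.exists_vecMul_eq_zero_iff.2 hsing
  have hz : ((A + P).map ι).mulVec x ≠ 0 := by
    intro h
    have h1 := Matrix.exists_mulVec_eq_zero_iff.1 ⟨x, hx0, h⟩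
    have h2 : ι (A + P).det = 0 := by
      rw [RingHom.map_det]
      exact h1
    exact hdet (hι (h2.trans (map_zero _).symm))
  obtain ⟨u, v, hvu, hu, hv⟩ := exists_orthogonal_detecting (F := F) hn y _ hy0 hz
  let cu : Fin n → Polynomial F := fun i => Polynomial.C (u i)
  let cv : Fin n → Polynomial F := fun i => Polynomial.C (v i)
  refine ⟨P + Matrix.vecMulVec cu (Matrix.vecMul cv (A + P)), ?_, ?_, ?_⟩
  · intro i j
    refine (Polynomial.degree_add_le _ _).trans (max_le (hP i j) ?_)
    simp only [Matrix.vecMul, dotProduct, cu, cv]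
    have h1 : ∀ (a : F) (p : Polynomial F), p.degree ≤ 1 → (Polynomial.C a * p).degree ≤ 1 := by
      intro a p hp
      rw [← Polynomial.smul_eq_C_mul]
      exact (Polynomial.degree_smul_le _ _).trans hp
    refine h1 _ _ ((Polynomial.degree_sum_le _ _).trans (Finset.sup_le fun l _ => h1 _ _ ?_))
    exact (Polynomial.degree_add_le _ _).trans (max_le (hA l j) (hP l j))
  · have h1 : (P + Matrix.vecMulVec cu (Matrix.vecMul cv (A + P))).map ι =
        P.map ι + Matrix.vecMulVec (fun i => algebraMap F (RatFunc F) (u i))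
          (Matrix.vecMul (fun i => algebraMap F (RatFunc F) (v i)) ((A + P).map ι)) := by
      ext i j
      simp only [Matrix.map_apply, Matrix.add_apply, Matrix.vecMulVec_apply, map_add, map_mul,
        Matrix.vecMul, dotProduct, map_sum, cu, cv, hcomp]
    change ((P + Matrix.vecMulVec cu (Matrix.vecMul cv (A + P))).map ι).rank = _
    rw [h1]
    refine rank_add_vecMulVec_eq _ _ _ x y hx hy ?_ hu
    rwa [← Matrix.dotProduct_mulVec]
  · have h1 : A + (P + Matrix.vecMulVec cu (Matrix.vecMul cv (A + P))) =
        (1 + Matrix.vecMulVec cu cv) * (A + P) := by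
      rw [add_mul, one_mul, Matrix.vecMulVec_mul, add_assoc]
    have h2 : cv ⬝ᵥ cu = 0 := by
      have := congrArg Polynomial.C hvu
      simpa [dotProduct, cu, cv] using this
    rw [h1, Matrix.det_mul, Matrix.vecMulVec_eq Unit, Matrix.det_one_add_replicateCol_mul_replicateRow,
      h2, add_zero, one_mul]

theorem exists_normalRank_eq {F : Type*} [Field F] {n : ℕ} (hn : 2 ≤ n)
    (A P : Matrix (Fin n) (Fin n) (Polynomial F)) (hA : IsPencil A) (hP : IsPencil P)
    (hdet : (A + P).det ≠ 0) {r : ℕ} (hr : r ≤ n) (hrank : normalRank P ≤ r) :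
    ∃ P' : Matrix (Fin n) (Fin n) (Polynomial F), IsPencil P' ∧
      normalRank P' = r ∧ (A + P').det = (A + P).det := by
  induction r, hrank using Nat.le_induction with
  | base => exact ⟨P, hP, rfl, rfl⟩
  | succ r hle ih =>
    obtain ⟨P', hP', hrk, hd⟩ := ih (Nat.le_of_succ_le hr)
    obtain ⟨P'', hP'', hrk', hd'⟩ :=
      exists_normalRank_succ hn A P' hA hP' (hd ▸ hdet) (hrk ▸ hr)
    exact ⟨P'', hP'', by rw [hrk', hrk], hd'.trans hd⟩

theorem det_submatrix_eq_zero_of_normalRank_lt {F : Type*} [Field F] {m n k : ℕ}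
    (P : Matrix (Fin m) (Fin n) (Polynomial F)) (hk : normalRank P < k)
    (ri : Fin k → Fin m) (ci : Fin k → Fin n) : (P.submatrix ri ci).det = 0 := by
  have hι : Function.Injective (algebraMap (Polynomial F) (RatFunc F)) :=
    IsFractionRing.injective _ _
  by_contra h
  have h1 : (((P.map (algebraMap (Polynomial F) (RatFunc F))).submatrix ri ci)).det ≠ 0 := by
    intro h0
    apply h
    apply hι
    rw [RingHom.map_det, map_zero]
    exact h0
  have h2 := Matrix.rank_of_isUnit _ ((Matrix.isUnit_iff_isUnit_det _).2 (Ne.isUnit h1))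
  have h3 := Matrix.rank_submatrix_le (P.map (algebraMap (Polynomial F) (RatFunc F))) ri ci
  rw [h2, Fintype.card_fin] at h3
  exact hk.not_ge h3

theorem pencilOf_coeff {F : Type*} [Field F] {m n : ℕ}
    {P : Matrix (Fin m) (Fin n) (Polynomial F)} (hP : IsPencil P) :
    pencilOf (P.map fun p => p.coeff 0) (P.map fun p => p.coeff 1) = P := by
  ext1 i j
  have h := Polynomial.eq_X_add_C_of_degree_le_one (hP i j)
  conv_rhs => rw [h]
  simp [pencilOf]
  ring

theorem isPencil_pencilOf {F : Type*} [Field F] {m n : ℕ} (G₀ G₁ : Matrix (Fin m) (Fin n) F) :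
    IsPencil (pencilOf G₀ G₁) := by
  intro i j
  simp only [pencilOf, Matrix.add_apply, Matrix.map_apply, Matrix.smul_apply, smul_eq_mul]
  rw [add_comm, mul_comm]
  exact Polynomial.degree_linear_le

theorem homPencil_add {F : Type*} [Field F] {m n : ℕ} (G₀ G₁ H₀ H₁ : Matrix (Fin m) (Fin n) F) :
    homPencil (G₀ + H₀) (G₁ + H₁) = homPencil G₀ G₁ + homPencil H₀ H₁ := by
  simp only [homPencil, Matrix.map_add _ (map_add _), smul_add]
  abel

theorem pencilOf_add {F : Type*} [Field F] {m n : ℕ} (G₀ G₁ H₀ H₁ : Matrix (Fin m) (Fin n) F) :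
    pencilOf (G₀ + H₀) (G₁ + H₁) = pencilOf G₀ G₁ + pencilOf H₀ H₁ := by
  simp only [pencilOf, Matrix.map_add _ (map_add _), smul_add]
  abel

theorem eval_one_zero_homogenize {R : Type*} [CommRing R] (p : Polynomial R) (n : ℕ) :
    MvPolynomial.eval ![1, 0] (p.homogenize n) = p.coeff n := by
  rw [Polynomial.homogenize, map_sum, Finset.sum_eq_single (n, 0)]
  · simp [MvPolynomial.eval_monomial, Finsupp.prod_fintype]
  · rintro ⟨a, b⟩ hab hne
    have hb : b ≠ 0 := by
      rintro rfl
      exact hne (by simpa using hab)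
    simp [MvPolynomial.eval_monomial, Finsupp.prod_fintype, hb]
  · simp

theorem dvd_homogenize_of_normalRank_le {F : Type*} [Field F] {k r : ℕ}
    (A₀ A₁ : Matrix (Fin (k + r)) (Fin (k + r)) F)
    (P : Matrix (Fin (k + r)) (Fin (k + r)) (Polynomial F)) (hP : IsPencil P)
    (hr : normalRank P ≤ r) {q : Polynomial F} {u : F} (hu : u ≠ 0)
    (hdet : (pencilOf A₀ A₁ + P).det = Polynomial.C u * q)
    {Φ : MvPolynomial (Fin 2) F}
    (hΦ : ∀ x ∈ minorsSet (homPencil A₀ A₁) k, Φ ∣ x) : Φ ∣ q.homogenize (k + r) := by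
  set P₀ := P.map fun p => p.coeff 0 with hP₀
  set P₁ := P.map fun p => p.coeff 1 with hP₁
  have hPP : pencilOf P₀ P₁ = P := pencilOf_coeff hP
  have h1 : Φ ∣ (homPencil A₀ A₁ + homPencil P₀ P₁).det := by
    refine dvd_det_add_of_minors le_rfl _ _
      (fun ri ci hri hci => hΦ _ ⟨ri, ci, hri, hci, rfl⟩) fun ri ci => ?_
    refine eq_of_aeval_eq_of_isHomogeneous
      (isHomogeneous_det _ fun _ _ => isHomogeneous_homPencil _ _ _ _)
      (MvPolynomial.isHomogeneous_zero _ _ _) ?_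
    rw [aeval_det_submatrix_homPencil, hPP, map_zero]
    exact det_submatrix_eq_zero_of_normalRank_lt P (Nat.lt_succ_of_le hr) ri ci
  rw [← homPencil_add] at h1
  rw [← Polynomial.homogenize_eq_of_isHomogeneous
    (isHomogeneous_det _ (isHomogeneous_homPencil _ _)) rfl] at h1
  have h2 := aeval_det_submatrix_homPencil (A₀ + P₀) (A₁ + P₁) id id
  rw [Matrix.submatrix_id_id, Matrix.submatrix_id_id, pencilOf_add, hPP, hdet] at h2
  rw [h2, Polynomial.homogenize_C_mul] at h1
  exact ((hu.isUnit.map MvPolynomial.C).dvd_mul_left).1 h1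

theorem le_sum_of_X_pow_dvd_prod {F σ ι : Type*} [Field F] (x : σ) (s : Finset ι)
    {φ : ι → MvPolynomial σ F} {m : ι → ℕ}
    (hm : ∀ i ∈ s, ¬ (MvPolynomial.X x : MvPolynomial σ F) ^ (m i + 1) ∣ φ i)
    {a : ℕ} (ha : (MvPolynomial.X x : MvPolynomial σ F) ^ a ∣ ∏ i ∈ s, φ i) :
    a ≤ ∑ i ∈ s, m i := by
  have h1 := le_emultiplicity_of_pow_dvd ha
  rw [Finset.emultiplicity_prod MvPolynomial.X_prime] at h1
  have h2 : ∑ i ∈ s, emultiplicity (MvPolynomial.X x) (φ i) ≤ ((∑ i ∈ s, m i : ℕ) : ℕ∞) := by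
    push_cast
    refine Finset.sum_le_sum fun i hi => ?_
    exact ENat.lt_add_one_iff (ENat.natCast_ne_top _) |>.1
      (by exact_mod_cast emultiplicity_lt_iff_not_dvd.2 (hm i hi))
  exact_mod_cast h1.trans h2

theorem isHomogeneous_aeval_of_linear {F : Type*} [Field F] {g : Fin 2 → MvPolynomial (Fin 2) F}
    (hg : ∀ i, (g i).IsHomogeneous 1) (p : MvPolynomial (Fin 2) F) (d : ℕ)
    (hp : p.IsHomogeneous d) : (MvPolynomial.aeval g p).IsHomogeneous d := by
  simpa using hp.aeval g hg

theorem exists_chart {F : Type*} [Field F] {n : ℕ} (A₀ A₁ : Matrix (Fin n) (Fin n) F)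
    {q : Polynomial F} (hqn : q.natDegree ≤ n)
    (hc : (∃ c : F, IsUnit (A₀ + c • A₁).det ∧ q.eval c ≠ 0) ∨
      (IsUnit A₁.det ∧ q.natDegree = n)) :
    ∃ (B₀ B₁ : Matrix (Fin n) (Fin n) F)
      (θ θ' : MvPolynomial (Fin 2) F →ₐ[F] MvPolynomial (Fin 2) F),
      (∀ p d, p.IsHomogeneous d → (θ p).IsHomogeneous d) ∧
      (∀ p d, p.IsHomogeneous d → (θ' p).IsHomogeneous d) ∧
      (∀ p, θ' (θ p) = p) ∧ (∀ p, θ (θ' p) = p) ∧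
      (homPencil A₀ A₁).map θ = homPencil B₀ B₁ ∧ IsUnit B₁.det ∧
      (MvPolynomial.aeval (![Polynomial.X, 1] : Fin 2 → Polynomial F)
        (θ (q.homogenize n))).natDegree = n := by
  obtain ⟨c, hc, hqc⟩ | ⟨hA₁, hq⟩ := hc
  · have hX := MvPolynomial.isHomogeneous_X (σ := Fin 2) F
    have hCX : ∀ i, (MvPolynomial.C c * MvPolynomial.X i :
        MvPolynomial (Fin 2) F).IsHomogeneous 1 := fun i => by
      simpa using (MvPolynomial.isHomogeneous_C (Fin 2) c).mul (hX i)
    let θ : MvPolynomial (Fin 2) F →ₐ[F] MvPolynomial (Fin 2) F := MvPolynomial.aeval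
      ![MvPolynomial.C c * MvPolynomial.X 0 + MvPolynomial.X 1, MvPolynomial.X 0]
    let θ' : MvPolynomial (Fin 2) F →ₐ[F] MvPolynomial (Fin 2) F := MvPolynomial.aeval
      ![MvPolynomial.X 1, MvPolynomial.X 0 - MvPolynomial.C c * MvPolynomial.X 1]
    have hθ : ∀ p d, p.IsHomogeneous d → (θ p).IsHomogeneous d :=
      isHomogeneous_aeval_of_linear fun i => by
        fin_cases i
        exacts [(hCX 0).add (hX 1), hX 0]
    have hθ' : ∀ p d, p.IsHomogeneous d → (θ' p).IsHomogeneous d :=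
      isHomogeneous_aeval_of_linear fun i => by
        fin_cases i
        exacts [hX 1, (hX 0).sub (hCX 1)]
    refine ⟨A₁, A₀ + c • A₁, θ, θ', hθ, hθ', fun p => ?_, fun p => ?_, ?_, hc, ?_⟩
    · have : θ'.comp θ = AlgHom.id F _ := by
        ext i : 1
        fin_cases i <;> simp [θ, θ', MvPolynomial.algHom_C]
      exact DFunLike.congr_fun this p
    · have : θ.comp θ' = AlgHom.id F _ := by
        ext i : 1
        fin_cases i <;> simp [θ, θ', MvPolynomial.algHom_C]
      exact DFunLike.congr_fun this p
    · ext1 i j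
      simp [homPencil, θ, MvPolynomial.algHom_C]
      ring
    · have hH := hθ _ _ (Polynomial.isHomogeneous_homogenize (n := n) q)
      refine le_antisymm (natDegree_aeval_le_of_isHomogeneous hH)
        (Polynomial.le_natDegree_of_ne_zero ?_)
      rw [← eval_one_zero_homogenize, Polynomial.homogenize_eq_of_isHomogeneous hH rfl]
      have h1 : MvPolynomial.eval ![1, 0] (θ (q.homogenize n)) =
          MvPolynomial.eval ![c, 1] (q.homogenize n) := by
        have : (MvPolynomial.aeval (![1, 0] : Fin 2 → F)).comp θ =
            MvPolynomial.aeval (![c, 1] : Fin 2 → F) := by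
          ext i : 1
          fin_cases i <;> simp [θ]
        exact DFunLike.congr_fun this _
      rw [h1, Polynomial.eval_homogenize hqn _ (by simp)]
      simpa using hqc
  · refine ⟨A₀, A₁, AlgHom.id F _, AlgHom.id F _, fun _ _ h => h, fun _ _ h => h, fun _ => rfl,
      fun _ => rfl, rfl, hA₁, ?_⟩
    rwa [AlgHom.id_apply, Polynomial.aeval_homogenize_X_one _ hqn]

theorem exists_isPencil_det_add {F : Type*} [Field F] {k r : ℕ}
    (A₀ A₁ : Matrix (Fin (k + r)) (Fin (k + r)) F) {q : Polynomial F} (hq : q ≠ 0)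
    (hqn : q.natDegree ≤ k + r)
    (hc : (∃ c : F, IsUnit (A₀ + c • A₁).det ∧ q.eval c ≠ 0) ∨
      (IsUnit A₁.det ∧ q.natDegree = k + r))
    (hdvd : ∀ (H : MvPolynomial (Fin 2) F) (h : ℕ), H.IsHomogeneous h →
      (∀ x ∈ minorsSet (homPencil A₀ A₁) k, H ∣ x) → H ∣ q.homogenize (k + r)) :
    ∃ P : Matrix (Fin (k + r)) (Fin (k + r)) (Polynomial F), IsPencil P ∧ normalRank P ≤ r ∧
      ∃ u : F, u ≠ 0 ∧ (pencilOf A₀ A₁ + P).det = Polynomial.C u * q := by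
  obtain ⟨B₀, B₁, θ, θ', hθ, hθ', hθθ', hθ'θ, hB, hB₁, hqθ⟩ := exists_chart A₀ A₁ hqn hc
  obtain ⟨K, l, u, hu, hK, hl, hdet⟩ := exists_perturbation_of_chart θ θ' hθ hθ' hθθ' hθ'θ hB hB₁
    hq hqn hqθ fun H h hH hdiv => hdvd H h hH (by
      rintro _ ⟨ri, ci, -, -, rfl⟩
      exact hdiv ri ci)
  refine ⟨l • K.map Polynomial.C, fun i j => ?_, ?_, u, hu, hdet⟩
  · rw [Matrix.smul_apply, smul_eq_mul, Matrix.map_apply, mul_comm, ← Polynomial.smul_eq_C_mul]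
    exact (Polynomial.degree_smul_le _ _).trans hl
  · have h1 : (l • K.map Polynomial.C).map (algebraMap (Polynomial F) (RatFunc F)) =
        Matrix.scalar _ (algebraMap (Polynomial F) (RatFunc F) l) *
          K.map (algebraMap F (RatFunc F)) := by
      ext i j
      simp
    rw [normalRank, h1]
    exact (Matrix.rank_mul_le_right _ _).trans hK

theorem le_of_X_pow_dvd_homogenize {F : Type*} [Field F] {n a : ℕ} {q : Polynomial F} (hq : q ≠ 0)
    (hqn : q.natDegree ≤ n)
    (h : (MvPolynomial.X 1 : MvPolynomial (Fin 2) F) ^ a ∣ q.homogenize n) :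
    a ≤ n - q.natDegree := by
  have hX : Prime (MvPolynomial.X 1 : MvPolynomial (Fin 2) F) := MvPolynomial.X_prime
  rw [homogenize_eq_mul_X_pow q hqn] at h
  refine (pow_dvd_pow_iff hX.ne_zero hX.not_isUnit).1 (hX.pow_dvd_of_dvd_mul_left a (fun hd => ?_) h)
  have h1 := map_dvd (MvPolynomial.eval (![1, 0] : Fin 2 → F)) hd
  rw [eval_one_zero_homogenize] at h1
  exact hq (by simpa using h1)

/-- Eigenvalue placement (Problem 2): for `n ≥ 2`, a regular pencil `A(s)`
with homogeneous invariant factors `φ` (whose dehomogenizations at `t = 1` are the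
invariant factors `α_i(s)` and whose `t`-multiplicities are `m i = m_i(∞, A(s))`), a
nonzero monic `q(s)` with `deg q ≤ n`, `F ∪ {∞}` not contained in `Λ(A(s)) ∪ Λⁿ(q)`, and
`0 ≤ r ≤ n`: there is a pencil `P(s)` of normal rank exactly `r` with
`det(A(s) + P(s)) = k q(s)`, `k ≠ 0`, iff `α₁ ⋯ α_{n-r} ∣ q` and
`Σ_{i=1}^{n-r} m_i(∞, A(s)) ≤ n - deg q`. -/
theorem stmt18 (F : Type*) [Field F] (n : ℕ) (hn : 2 ≤ n)
    (A₀ A₁ : Matrix (Fin n) (Fin n) F) (hA : (pencilOf A₀ A₁).det ≠ 0)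
    (φ : ℕ → MvPolynomial (Fin 2) F)
    (hφ : IsHomogeneousIF A₀ A₁ φ) (hφc : ∀ i, i + 1 < n → φ i ∣ φ (i + 1))
    (m : ℕ → ℕ)
    (hm : ∀ i < n, (MvPolynomial.X 1 : MvPolynomial (Fin 2) F) ^ (m i) ∣ φ i ∧
      ¬ (MvPolynomial.X 1 : MvPolynomial (Fin 2) F) ^ (m i + 1) ∣ φ i)
    (q : Polynomial F) (hq0 : q ≠ 0) (hqm : q.Monic) (hqd : q.natDegree ≤ n)
    (hc : (∃ c : F, IsUnit (A₀ + c • A₁).det ∧ q.eval c ≠ 0) ∨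
      (IsUnit A₁.det ∧ q.natDegree = n))
    (r : ℕ) (hr : r ≤ n) :
    (∃ P : Matrix (Fin n) (Fin n) (Polynomial F), IsPencil P ∧ normalRank P = r ∧
        ∃ k : F, k ≠ 0 ∧ (pencilOf A₀ A₁ + P).det = Polynomial.C k * q) ↔
      ((∏ i ∈ Finset.range (n - r),
          MvPolynomial.aeval (![Polynomial.X, 1] : Fin 2 → Polynomial F) (φ i)) ∣ q ∧
        (∑ i ∈ Finset.range (n - r), m i) ≤ n - q.natDegree) := by
  obtain ⟨k, rfl⟩ := Nat.exists_eq_add_of_le' hr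
  rw [Nat.add_sub_cancel, ← map_prod]
  have hΦ := hφ k (Nat.le_add_right k r)
  have hmk : ∀ i ∈ Finset.range k, i < k + r := fun i hi =>
    (Finset.mem_range.1 hi).trans_le (Nat.le_add_right k r)
  constructor
  · rintro ⟨P, hP, hPr, u, hu, hdet⟩
    have h1 := dvd_homogenize_of_normalRank_le A₀ A₁ P hP hPr.le hu hdet hΦ.1
    refine ⟨?_, le_of_X_pow_dvd_homogenize hq0 hqd (Dvd.dvd.trans ?_ h1)⟩
    · have h2 := map_dvd (MvPolynomial.aeval (![Polynomial.X, 1] : Fin 2 → Polynomial F)) h1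
      rwa [Polynomial.aeval_homogenize_X_one _ hqd] at h2
    · rw [← Finset.prod_pow_eq_pow_sum]
      exact Finset.prod_dvd_prod_of_dvd _ _ fun i hi => (hm i (hmk i hi)).1
  · rintro ⟨hdvd, hsum⟩
    obtain ⟨P, hP, hPr, u, hu, hdet⟩ := exists_isPencil_det_add A₀ A₁ hq0 hqd hc
      fun H h hH hdiv => dvd_homogenize_of_dvd hqd hH (hΦ.2 H hdiv) hdvd fun a ha =>
        (le_sum_of_X_pow_dvd_prod 1 _ (fun i hi => (hm i (hmk i hi)).2) ha).trans hsum
    obtain ⟨P', hP', hrk, hdet'⟩ := exists_normalRank_eq hn (pencilOf A₀ A₁) P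
      (isPencil_pencilOf A₀ A₁) hP
      (hdet ▸ mul_ne_zero (Polynomial.C_ne_zero.2 hu) hq0) hr hPr
    exact ⟨P', hP', hrk, u, hu, hdet'.trans hdet⟩
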